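/- Suppose the parameters of P-GRPDA satisfy the extended conditions 0 < 3μ' < μ < ψ/2 + ψ(1 + ψ − ψ²)/(2(ψ+1)) with ψ ∈ (1, 1+√3). Then the sequence (x_n, y_n) generated by Algorithm 1 converges to a pair (x̃, ỹ) ∈ X × Y such that (x̃, Kx̃, ỹ) is a saddle point of the Lagrangian 𝓛. -/

import Mathlib

open Filter Topology
local notation "⟪" x ", " y "⟫_ℝ" => @inner ℝ _ _ x y

lemma aux_i1 {X : Type*} [NormedAddCommGroup X] [InnerProductSpace ℝ X] (a b c : X) :
    2 * ⟪a - b, c - a⟫_ℝ = ‖c - b‖^2 - ‖a - b‖^2 - ‖c - a‖^2 := by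
  have : c - b = (c - a) + (a - b) := by abel
  rw [this, norm_add_sq_real, real_inner_comm]; ring

lemma aux_i3 {X : Type*} [NormedAddCommGroup X] [InnerProductSpace ℝ X] (ψ : ℝ) (hψ : 1 < ψ)
    (x2 z2 z3 xb : X) (hz : z3 = ((ψ - 1) / ψ) • x2 + (1 / ψ) • z2) :
    ψ / (ψ - 1) * ‖z3 - xb‖^2 = ‖x2 - xb‖^2 + 1 / (ψ - 1) * ‖z2 - xb‖^2
      - 1 / ψ * ‖x2 - z2‖^2 := by
  have h0 : ψ ≠ 0 := by linarith
  have h1 : ψ - 1 ≠ 0 := by linarith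
  have e1 : z3 - xb = ((ψ - 1) / ψ) • (x2 - xb) + (1 / ψ) • (z2 - xb) := by
    rw [hz]
    have : xb = ((ψ - 1) / ψ) • xb + (1 / ψ) • xb := by
      rw [← add_smul]
      have : (ψ - 1) / ψ + 1 / ψ = 1 := by field_simp; ring
      rw [this, one_smul]
    nth_rewrite 1 [this]
    module
  have e2 : x2 - z2 = (x2 - xb) - (z2 - xb) := by abel
  rw [e1, e2, norm_add_sq_real, norm_sub_sq_real (x2 - xb) (z2 - xb), norm_smul, norm_smul, real_inner_smul_left,
    real_inner_smul_right, mul_pow, mul_pow, Real.norm_eq_abs, Real.norm_eq_abs, sq_abs, sq_abs]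
  field_simp
  ring

lemma aux_i4 {X : Type*} [NormedAddCommGroup X] [InnerProductSpace ℝ X] (S P : ℝ) (hS : S ≠ 0)
    (a d : X) :
    S * ‖a + ((S - P) / S) • d‖^2 = (S - P) * ‖a + d‖^2 + P * ‖a‖^2
      - (S - P) * P / S * ‖d‖^2 := by
  rw [norm_add_sq_real, norm_add_sq_real, norm_smul, real_inner_smul_right, mul_pow,
    Real.norm_eq_abs, sq_abs]
  field_simp
  ring

lemma aux_grad {X : Type*} [NormedAddCommGroup X] [InnerProductSpace ℝ X] [CompleteSpace X]
    (h : X → ℝ) (Gh : X → X) (hh : ConvexOn ℝ Set.univ h)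
    (hGh : ∀ a : X, HasGradientAt h (Gh a) a) (a b : X) :
    ⟪Gh a, b - a⟫_ℝ ≤ h b - h a := by
  let γ : ℝ → X := fun t => a + t • (b - a)
  have hc : ConvexOn ℝ Set.univ (fun t : ℝ => h (AffineMap.lineMap a b t)) := by
    have := hh.comp_affineMap (AffineMap.lineMap a b : ℝ →ᵃ[ℝ] X)
    simpa [Function.comp_def] using this
  have hd : HasDerivAt (fun t : ℝ => h (AffineMap.lineMap a b t)) (⟪Gh a, b - a⟫_ℝ) 0 := by
    have h1 : HasDerivAt (fun t : ℝ => (AffineMap.lineMap a b t : X)) (b - a) 0 :=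
      AffineMap.hasDerivAt_lineMap
    have h2 : HasFDerivAt h (InnerProductSpace.toDual ℝ X (Gh a)) (AffineMap.lineMap a b (0:ℝ)) := by
      simpa using (hGh a).hasFDerivAt
    have := h2.comp_hasDerivAt (0:ℝ) h1
    simpa [Function.comp_def] using this
  have := hc.le_slope_of_hasDerivAt (Set.mem_univ (0:ℝ)) (Set.mem_univ (1:ℝ)) one_pos hd
  simpa [slope_def_field] using this

lemma aux_step {X Y : Type*}
    [NormedAddCommGroup X] [InnerProductSpace ℝ X] [CompleteSpace X]
    [NormedAddCommGroup Y] [InnerProductSpace ℝ Y] [CompleteSpace Y]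
    (K : X →L[ℝ] Y)
    (f : X → ℝ) (g : Y → ℝ) (h : X → ℝ) (Gh : X → X)
    (hgr : ∀ a b : X, ⟪Gh a, b - a⟫_ℝ ≤ h b - h a)
    (ψ β κ μ' : ℝ) (hψ1 : 1 < ψ) (hβ : 0 < β) (hμ'0 : 0 < μ') (hκ : 0 < κ)
    (xb : X) (yb : Y)
    (hs : ∀ (x' : X) (w' : Y), f xb + h xb + g (K xb) ≤ f x' + h x' + g w' + ⟪yb, K x' - w'⟫_ℝ)
    (x0 x1 x2 z1 z2 z3 : X) (w1 y0 y1 : Y) (t0 t1 δ S : ℝ)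
    (ht0 : 0 < t0) (ht1 : t1 = δ * t0) (hδ : 0 < δ) (hS : S = 1 + 1 / ψ)
    (hz2 : z2 = ((ψ - 1) / ψ) • x1 + (1 / ψ) • z1)
    (hz3 : z3 = ((ψ - 1) / ψ) • x2 + (1 / ψ) • z2)
    (hx1 : t0 * (f x1 - f x2) ≤
        ⟪x1 - z1 + t0 • (ContinuousLinearMap.adjoint K) y0 + t0 • Gh x0, x2 - x1⟫_ℝ)
    (hx2 : t1 * (f x2 - f xb) ≤
        ⟪x2 - z2 + t1 • (ContinuousLinearMap.adjoint K) y1 + t1 • Gh x1, xb - x2⟫_ℝ)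
    (hw : g w1 - g (K xb) ≤ ⟪y1, w1 - K xb⟫_ℝ)
    (hy : y1 = y0 + (β * t1) • (K x1 - w1))
    (hK : t1 * (Real.sqrt β * ‖K (x2 - x1)‖) ≤ κ * ‖x2 - x1‖)
    (hG : t1 * ‖Gh x1 - Gh x0‖ ≤ μ' * ‖x1 - x0‖) :
    (ψ / (ψ - 1) * ‖z3 - xb‖^2 + 1 / β * ‖y1 - yb‖^2 + μ' * ‖x2 - x1‖^2)
     + ((1 - κ) / β * ‖y1 - y0‖^2 + (ψ * δ + (S - ψ * δ) * (ψ * δ) / S - κ - 2 * μ') * ‖x2 - x1‖^2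
     + S * ‖(x1 - z2) + ((S - ψ * δ) / S) • (x2 - x1)‖^2)
     ≤ ψ / (ψ - 1) * ‖z2 - xb‖^2 + 1 / β * ‖y0 - yb‖^2 + μ' * ‖x1 - x0‖^2 := by
  have h0 : ψ ≠ 0 := by linarith
  have h1 : ψ - 1 ≠ 0 := by linarith
  have hSp : 0 < S := by rw [hS]; positivity
  have e1 := aux_i1 x2 z2 xb
  have e2 := aux_i1 x1 z2 x2
  have e3 := aux_i3 ψ hψ1 x2 z2 z3 xb hz3
  have e4 := aux_i4 S (ψ * δ) hSp.ne' (x1 - z2) (x2 - x1)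
  have e4' : x1 - z2 + (x2 - x1) = x2 - z2 := by abel
  rw [e4'] at e4
  have e5 := aux_i1 y1 y0 yb
  have ezz : x1 - z1 = ψ • (x1 - z2) := by
    rw [hz2, smul_sub, smul_add, smul_smul, smul_smul]
    have a1 : ψ * ((ψ - 1) / ψ) = ψ - 1 := by field_simp
    have a2 : ψ * (1 / ψ) = 1 := by field_simp
    rw [a1, a2]; module
  -- x1 inequality
  have k1 : t1 * (f x1 - f x2) ≤ δ * ψ * ⟪x1 - z2, x2 - x1⟫_ℝ + t1 * ⟪y0, K (x2 - x1)⟫_ℝ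
      + t1 * ⟪Gh x0, x2 - x1⟫_ℝ := by
    rw [ezz, inner_add_left, inner_add_left, real_inner_smul_left, real_inner_smul_left,
      real_inner_smul_left, ContinuousLinearMap.adjoint_inner_left] at hx1
    have := mul_le_mul_of_nonneg_left hx1 hδ.le
    rw [ht1]; linarith
  have k2 : t1 * (f x2 - f xb) ≤ ⟪x2 - z2, xb - x2⟫_ℝ + t1 * ⟪y1, K (xb - x2)⟫_ℝ
      + t1 * ⟪Gh x1, xb - x2⟫_ℝ := by
    rw [inner_add_left, inner_add_left, real_inner_smul_left,
      real_inner_smul_left, ContinuousLinearMap.adjoint_inner_left] at hx2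
    exact hx2
  have ht1p : 0 < t1 := by rw [ht1]; positivity
  have k3 := mul_le_mul_of_nonneg_left (hgr x1 xb) ht1p.le
  have k4 : t1 * ⟪Gh x1 - Gh x0, x1 - x2⟫_ℝ ≤ μ' / 2 * (‖x1 - x0‖^2 + ‖x2 - x1‖^2) := by
    have a1 := real_inner_le_norm (Gh x1 - Gh x0) (x1 - x2)
    rw [norm_sub_rev x1 x2] at a1
    have a2 := mul_le_mul_of_nonneg_left a1 ht1p.le
    have a3 := mul_le_mul_of_nonneg_right hG (norm_nonneg (x2 - x1))
    have a4 := mul_le_mul_of_nonneg_left (two_mul_le_add_sq ‖x1 - x0‖ ‖x2 - x1‖) hμ'0.le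
    linarith
  have k5 : t1 * ⟪y1 - y0, K (x1 - x2)⟫_ℝ ≤ κ / 2 * (1 / β * ‖y1 - y0‖^2 + ‖x2 - x1‖^2) := by
    have hsb : 0 < Real.sqrt β := Real.sqrt_pos.2 hβ
    have hsq : Real.sqrt β ^ 2 = β := Real.sq_sqrt hβ.le
    have a1 := real_inner_le_norm (y1 - y0) (K (x1 - x2))
    have a0 : ‖K (x1 - x2)‖ = ‖K (x2 - x1)‖ := by
      rw [← neg_sub x2 x1, map_neg, norm_neg]
    rw [a0] at a1
    have a2 := mul_le_mul_of_nonneg_left a1 ht1p.le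
    have a3 := mul_le_mul_of_nonneg_left hK (by positivity : 0 ≤ ‖y1 - y0‖ / Real.sqrt β)
    have a4 := mul_le_mul_of_nonneg_left (two_mul_le_add_sq (‖y1 - y0‖ / Real.sqrt β) ‖x2 - x1‖) hκ.le
    have a5 : (‖y1 - y0‖ / Real.sqrt β)^2 = 1 / β * ‖y1 - y0‖^2 := by
      rw [div_pow, hsq]; ring
    have a6 : ‖y1 - y0‖ / √β * (t1 * (√β * ‖K (x2 - x1)‖)) = t1 * (‖y1 - y0‖ * ‖K (x2 - x1)‖) := by
      field_simp
    rw [a5] at a4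
    rw [a6] at a3
    linarith
  have k6 := mul_le_mul_of_nonneg_left (hs x1 w1) ht1p.le
  have k7 := mul_le_mul_of_nonneg_left hw ht1p.le
  have k8 : t1 * ⟪y1 - yb, K x1 - w1⟫_ℝ = 1 / β * ⟪y1 - yb, y1 - y0⟫_ℝ := by
    have : y1 - y0 = (β * t1) • (K x1 - w1) := by rw [hy]; abel
    rw [this, real_inner_smul_right]; field_simp
  have e5' : 2 * (1 / β * ⟪y1 - yb, y1 - y0⟫_ℝ) =
      1 / β * ‖y1 - yb‖^2 + 1 / β * ‖y1 - y0‖^2 - 1 / β * ‖y0 - yb‖^2 := by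
    have a : ⟪y1 - yb, y1 - y0⟫_ℝ = - ⟪y1 - y0, yb - y1⟫_ℝ := by
      rw [← neg_sub yb y1, inner_neg_left, real_inner_comm]
    rw [a, norm_sub_rev y1 yb, norm_sub_rev y0 yb]
    linear_combination (-1 / β) * e5
  have c1 : 1 / (ψ - 1) * ‖z2 - xb‖ ^ 2 + ‖z2 - xb‖^2 = ψ / (ψ - 1) * ‖z2 - xb‖^2 := by
    field_simp; ring
  have c2 : S * ‖x2 - z2‖^2 = ‖x2 - z2‖^2 + 1 / ψ * ‖x2 - z2‖^2 := by rw [hS]; ring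
  have c3 : (1 - κ) / β * ‖y1 - y0‖^2 = 1 / β * ‖y1 - y0‖^2 - κ * (1 / β * ‖y1 - y0‖^2) := by ring
  have e2' : δ * ψ * (2 * ⟪x1 - z2, x2 - x1⟫_ℝ) = _ := congrArg (fun s => δ * ψ * s) e2
  rw [norm_sub_rev xb z2, norm_sub_rev xb x2] at e1
  simp only [map_sub, inner_sub_left, inner_sub_right] at *
  linarith

lemma aux_seq (E D : ℕ → ℝ) (N : ℕ) (hE : ∀ n, 0 ≤ E n) (hD : ∀ n, N ≤ n → 0 ≤ D n)
    (h : ∀ n, N ≤ n → E (n+1) + D n ≤ E n) :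
    Tendsto D atTop (𝓝 0) ∧ ∃ l, Tendsto E atTop (𝓝 l) := by
  have hanti : Antitone (fun n => E (n + N)) := by
    refine antitone_nat_of_succ_le fun n => ?_
    have h1 := h (n + N) (by omega)
    have h2 := hD (n + N) (by omega)
    have : n + 1 + N = n + N + 1 := by omega
    simp only [this]; linarith
  have hbdd : BddBelow (Set.range fun n => E (n + N)) := ⟨0, by rintro _ ⟨n, rfl⟩; exact hE _⟩
  have hlim := tendsto_atTop_ciInf hanti hbdd
  have hlim2 := (tendsto_add_atTop_iff_nat (f := E) N).1 hlim
  refine ⟨?_, _, hlim2⟩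
  have h3 := hlim2.sub ((tendsto_add_atTop_iff_nat (f := E) 1).2 hlim2)
  rw [sub_self] at h3
  refine tendsto_of_tendsto_of_tendsto_of_le_of_le' tendsto_const_nhds h3 ?_ ?_
  · filter_upwards [eventually_ge_atTop N] with n hn using hD n hn
  · filter_upwards [eventually_ge_atTop N] with n hn
    have := h n hn
    linarith

lemma aux_sq0 {X : Type*} [NormedAddCommGroup X] (v : ℕ → X) (D : ℕ → ℝ) (c : ℝ) (hc : 0 < c)
    (hD : Tendsto D atTop (𝓝 0)) (h : ∀ᶠ n in atTop, c * ‖v n‖^2 ≤ D n) :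
    Tendsto v atTop (𝓝 0) := by
  rw [tendsto_zero_iff_norm_tendsto_zero]
  have h1 : Tendsto (fun n => ‖v n‖^2) atTop (𝓝 0) := by
    have h2 := hD.div_const c
    rw [zero_div] at h2
    refine tendsto_of_tendsto_of_tendsto_of_le_of_le' tendsto_const_nhds h2
      (Eventually.of_forall fun n => by positivity) ?_
    filter_upwards [h] with n hn
    rw [le_div_iff₀ hc]; linarith
  have h3 := h1.sqrt
  simpa using h3

lemma aux_kappa (ψ μ μ' : ℝ) (hψ1 : 1 < ψ) (hμ'0 : 0 < μ') (hμμ' : 3 * μ' < μ)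
    (hμψ : μ < ψ / 2 + ψ * (1 + ψ - ψ ^ 2) / (2 * (ψ + 1))) :
    ∃ κ, μ < κ ∧ κ < 1 ∧ 0 < 2 * μ - κ - 2 * μ' := by
  have h1 : μ < 1 := by
    have : ψ / 2 + ψ * (1 + ψ - ψ ^ 2) / (2 * (ψ + 1)) < 1 := by
      have e : ψ / 2 + ψ * (1 + ψ - ψ ^ 2) / (2 * (ψ + 1))
        = (ψ * (2 + 2 * ψ - ψ^2)) / (2 * (ψ + 1)) := by field_simp; ring
      rw [e, div_lt_one (by linarith)]
      nlinarith [mul_nonneg (by linarith : (0:ℝ) ≤ ψ) (sq_nonneg (ψ - 4/3)), sq_nonneg (ψ - 4/3)]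
    linarith
  obtain ⟨κ, h2, h3⟩ := exists_between (show μ < min 1 (4 * μ / 3) from lt_min h1 (by linarith))
  have := lt_min_iff.1 h3
  exact ⟨κ, h2, this.1, by linarith [this.2]⟩

lemma aux_M (ψ μ : ℝ) (hψ1 : 1 < ψ) (d : ℕ → ℝ) (hd : Tendsto d atTop (𝓝 1))
    (hμψ : μ < ψ / 2 + ψ * (1 + ψ - ψ ^ 2) / (2 * (ψ + 1))) (S : ℝ) (hS : S = 1 + 1 / ψ) :
    ∀ᶠ n in atTop, 2 * μ < ψ * d n + (S - ψ * d n) * (ψ * d n) / S := by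
  have h1 : Tendsto (fun n => ψ * d n + (S - ψ * d n) * (ψ * d n) / S) atTop
      (𝓝 (ψ * 1 + (S - ψ * 1) * (ψ * 1) / S)) := by
    have a := hd.const_mul ψ
    exact a.add (((tendsto_const_nhds.sub a).mul a).div_const S)
  refine h1.eventually_const_lt ?_
  have : ψ * 1 + (S - ψ * 1) * (ψ * 1) / S
    = 2 * (ψ / 2 + ψ * (1 + ψ - ψ ^ 2) / (2 * (ψ + 1))) := by
    rw [hS]; have : ψ ≠ 0 := by linarith
    have : ψ + 1 ≠ 0 := by linarith
    field_simp
    ring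
  rw [this]; linarith

lemma aux_tau {X Y : Type*}
    [NormedAddCommGroup X] [InnerProductSpace ℝ X]
    [NormedAddCommGroup Y] [InnerProductSpace ℝ Y]
    (K : X →L[ℝ] Y) (hK : K ≠ 0) (Gh : X → X)
    (L : ℝ) (hL : 0 < L) (hLip : ∀ a b : X, ‖Gh a - Gh b‖ ≤ L * ‖a - b‖)
    (β μ μ' : ℝ) (hβ : 0 < β) (hμ'0 : 0 < μ') (hμ0 : 0 < μ)
    (x : ℕ → X) (τ : ℕ → ℝ)
    (hτ0 : 0 < τ 0)
    (hτ : ∀ n, 1 ≤ n → τ n = min (τ (n - 1)) (min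
        (if ‖K (x n - x (n - 1))‖ = 0 then τ (n - 1)
          else μ * ‖x n - x (n - 1)‖ / (Real.sqrt β * ‖K (x n - x (n - 1))‖))
        (if ‖Gh (x n) - Gh (x (n - 1))‖ = 0 then τ (n - 1)
          else μ' * ‖x n - x (n - 1)‖ / ‖Gh (x n) - Gh (x (n - 1))‖))) :
    (∃ T, 0 < T ∧ Tendsto τ atTop (𝓝 T)) ∧ (∀ n, 0 < τ n) ∧
    (∀ n, τ (n+1) * (Real.sqrt β * ‖K (x (n+1) - x n)‖) ≤ μ * ‖x (n+1) - x n‖) ∧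
    (∀ n, τ (n+1) * ‖Gh (x (n+1)) - Gh (x n)‖ ≤ μ' * ‖x (n+1) - x n‖) := by
  have hsb : 0 < Real.sqrt β := Real.sqrt_pos.2 hβ
  have hKn : 0 < ‖K‖ := norm_pos_iff.2 hK
  have hτ' : ∀ n, τ (n+1) = min (τ n) (min
        (if ‖K (x (n+1) - x n)‖ = 0 then τ n
          else μ * ‖x (n+1) - x n‖ / (Real.sqrt β * ‖K (x (n+1) - x n)‖))
        (if ‖Gh (x (n+1)) - Gh (x n)‖ = 0 then τ n
          else μ' * ‖x (n+1) - x n‖ / ‖Gh (x (n+1)) - Gh (x n)‖)) := fun n => by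
    simpa using hτ (n+1) (by omega)
  set m := min (τ 0) (min (μ / (Real.sqrt β * ‖K‖)) (μ' / L)) with hm
  have hmpos : 0 < m := by
    refine lt_min hτ0 (lt_min ?_ ?_) <;> positivity
  have hlow : ∀ n, m ≤ τ n := by
    intro n
    induction n with
    | zero => exact min_le_left _ _
    | succ n ih =>
      rw [hτ' n]
      refine le_min ih (le_min ?_ ?_)
      · split_ifs with h0
        · exact ih
        · have hp : 0 < ‖K (x (n+1) - x n)‖ := lt_of_le_of_ne (norm_nonneg _) (Ne.symm h0)
          refine ((min_le_right _ _).trans (min_le_left _ _)).trans ?_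
          rw [div_le_div_iff₀ (by positivity) (by positivity)]
          have := K.le_opNorm (x (n+1) - x n)
          have := mul_le_mul_of_nonneg_left this (by positivity : 0 ≤ μ * √β)
          linarith
      · split_ifs with h0
        · exact ih
        · have hp : 0 < ‖Gh (x (n+1)) - Gh (x n)‖ := lt_of_le_of_ne (norm_nonneg _) (Ne.symm h0)
          refine ((min_le_right _ _).trans (min_le_right _ _)).trans ?_
          rw [div_le_div_iff₀ (by positivity) (by positivity)]
          have := hLip (x (n+1)) (x n)
          have := mul_le_mul_of_nonneg_left this hμ'0.le
          linarith
  have hanti : Antitone τ := antitone_nat_of_succ_le fun n => by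
    rw [hτ' n]; exact min_le_left _ _
  have hbdd : BddBelow (Set.range τ) := ⟨m, by rintro _ ⟨n, rfl⟩; exact hlow n⟩
  have hlim := tendsto_atTop_ciInf hanti hbdd
  refine ⟨⟨_, lt_of_lt_of_le hmpos (ge_of_tendsto' hlim hlow), hlim⟩,
    fun n => hmpos.trans_le (hlow n), fun n => ?_, fun n => ?_⟩
  · by_cases h0 : ‖K (x (n+1) - x n)‖ = 0
    · rw [h0]; simp; positivity
    · have hp : 0 < ‖K (x (n+1) - x n)‖ := lt_of_le_of_ne (norm_nonneg _) (Ne.symm h0)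
      rw [← le_div_iff₀ (by positivity)]
      have := ((hτ' n).le.trans (min_le_right _ _)).trans (min_le_left _ _)
      rwa [if_neg h0] at this
  · by_cases h0 : ‖Gh (x (n+1)) - Gh (x n)‖ = 0
    · rw [h0]; simp; positivity
    · have hp : 0 < ‖Gh (x (n+1)) - Gh (x n)‖ := lt_of_le_of_ne (norm_nonneg _) (Ne.symm h0)
      rw [← le_div_iff₀ (by positivity)]
      have := ((hτ' n).le.trans (min_le_right _ _)).trans (min_le_right _ _)
      rwa [if_neg h0] at this

theorem pgrpda_extended_region_convergence {X Y : Type*}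
    [NormedAddCommGroup X] [InnerProductSpace ℝ X] [FiniteDimensional ℝ X]
    [NormedAddCommGroup Y] [InnerProductSpace ℝ Y] [FiniteDimensional ℝ Y]
    (K : X →L[ℝ] Y) (hK : K ≠ 0)
    (f : X → ℝ) (g : Y → ℝ) (h : X → ℝ) (Gh : X → X)
    (hf : ConvexOn ℝ Set.univ f) (hg : ConvexOn ℝ Set.univ g)
    (hh : ConvexOn ℝ Set.univ h)
    (hGh : ∀ a : X, HasGradientAt h (Gh a) a)
    (L : ℝ) (hL : 0 < L) (hLip : ∀ a b : X, ‖Gh a - Gh b‖ ≤ L * ‖a - b‖)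
    (ψ β μ μ' : ℝ) (hψ1 : 1 < ψ) (hψ3 : ψ < 1 + Real.sqrt 3)
    (hβ : 0 < β) (hμ'0 : 0 < μ') (hμμ' : 3 * μ' < μ)
    (hμψ : μ < ψ / 2 + ψ * (1 + ψ - ψ ^ 2) / (2 * (ψ + 1)))
    (xb : X) (wb yb : Y)
    (hsaddle : ∀ (x' : X) (w' y' : Y),
      f xb + h xb + g wb + ⟪y', K xb - wb⟫_ℝ ≤
          f xb + h xb + g wb + ⟪yb, K xb - wb⟫_ℝ ∧
        f xb + h xb + g wb + ⟪yb, K xb - wb⟫_ℝ ≤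
          f x' + h x' + g w' + ⟪yb, K x' - w'⟫_ℝ)
    (x z : ℕ → X) (w y : ℕ → Y) (τ : ℕ → ℝ)
    (hτ0 : 0 < τ 0) (hz0 : z 0 = x 0)
    (hz : ∀ n, 1 ≤ n → z n = ((ψ - 1) / ψ) • x (n - 1) + (1 / ψ) • z (n - 1))
    (hx : ∀ n, 1 ≤ n → ∀ u : X,
      τ (n - 1) * (f (x n) - f u) ≤
        ⟪x n - z n + τ (n - 1) • (ContinuousLinearMap.adjoint K) (y (n - 1))
            + τ (n - 1) • Gh (x (n - 1)), u - x n⟫_ℝ)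
    (hτ : ∀ n, 1 ≤ n → τ n = min (τ (n - 1)) (min
        (if ‖K (x n - x (n - 1))‖ = 0 then τ (n - 1)
          else μ * ‖x n - x (n - 1)‖ / (Real.sqrt β * ‖K (x n - x (n - 1))‖))
        (if ‖Gh (x n) - Gh (x (n - 1))‖ = 0 then τ (n - 1)
          else μ' * ‖x n - x (n - 1)‖ / ‖Gh (x n) - Gh (x (n - 1))‖)))
    (hw : ∀ n, 1 ≤ n → ∀ v : Y,
      g (w n) - g v ≤ ⟪y (n - 1) + (β * τ n) • (K (x n) - w n), w n - v⟫_ℝ)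
    (hy : ∀ n, 1 ≤ n → y n = y (n - 1) + (β * τ n) • (K (x n) - w n)) :
    ∃ (xt : X) (yt : Y),
      Filter.Tendsto (fun n => (x n, y n)) Filter.atTop (nhds (xt, yt)) ∧
      (∀ y' : Y, f xt + h xt + g (K xt) + ⟪y', K xt - K xt⟫_ℝ ≤
          f xt + h xt + g (K xt) + ⟪yt, K xt - K xt⟫_ℝ) ∧
      (∀ (x' : X) (w' : Y), f xt + h xt + g (K xt) + ⟪yt, K xt - K xt⟫_ℝ ≤
          f x' + h x' + g w' + ⟪yt, K x' - w'⟫_ℝ) := by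
  have hμ0 : 0 < μ := by linarith
  obtain ⟨⟨T, hT, hτT⟩, hτp, hτK, hτG⟩ :=
    aux_tau K hK Gh L hL hLip β μ μ' hβ hμ'0 hμ0 x τ hτ0 hτ
  obtain ⟨κ, hκ1, hκ2, hκ3⟩ := aux_kappa ψ μ μ' hψ1 hμ'0 hμμ' hμψ
  have hgr := aux_grad h Gh hh hGh
  have hfc : Continuous f := by
    rw [← continuousOn_univ]; exact hf.continuousOn isOpen_univ
  have hgc : Continuous g := by
    rw [← continuousOn_univ]; exact hg.continuousOn isOpen_univ
  have hGc : Continuous Gh := by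
    have : LipschitzWith L.toNNReal Gh := LipschitzWith.of_dist_le_mul fun a b => by
      rw [dist_eq_norm, dist_eq_norm, Real.coe_toNNReal _ hL.le]; exact hLip a b
    exact this.continuous
  obtain ⟨S, hS⟩ : ∃ S : ℝ, S = 1 + 1 / ψ := ⟨_, rfl⟩
  have hψ0 : 0 < ψ := by linarith
  have hψm : 0 < ψ - 1 := by linarith
  have hSp : 0 < S := by rw [hS]; positivity
  have hτT1 := (tendsto_add_atTop_iff_nat (f := τ) 1).2 hτT
  have hτT2 := (tendsto_add_atTop_iff_nat (f := τ) 2).2 hτT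
  have hδ : Tendsto (fun n => τ (n+1) / τ n) atTop (𝓝 1) := by
    have := hτT1.div hτT hT.ne'
    rwa [div_self hT.ne'] at this
  have hρ : ∀ᶠ n in atTop, μ * τ (n+1) / τ (n+2) < κ := by
    have := (hτT1.const_mul μ).div hτT2 hT.ne'
    rw [mul_div_assoc, div_self hT.ne', mul_one] at this
    exact this.eventually_lt_const hκ1
  have hM := aux_M ψ μ hψ1 _ hδ hμψ S hS
  obtain ⟨N, hN⟩ := eventually_atTop.1 (hρ.and hM)
  obtain ⟨V, hV⟩ : ∃ V : ℕ → X, V = fun n => (x (n+1) - z (n+2)) +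
    ((S - ψ * (τ (n+1) / τ n)) / S) • (x (n+2) - x (n+1)) := ⟨_, rfl⟩
  obtain ⟨D, hD⟩ : ∃ D : ℕ → ℝ, D = fun n => (1 - κ) / β * ‖y (n+1) - y n‖^2
    + (2 * μ - κ - 2 * μ') * ‖x (n+2) - x (n+1)‖^2 + S * ‖V n‖^2 := ⟨_, rfl⟩
  obtain ⟨E, hE⟩ : ∃ E : X → Y → ℕ → ℝ, E = fun a b n => ψ / (ψ - 1) * ‖z (n+2) - a‖^2
    + 1 / β * ‖y n - b‖^2 + μ' * ‖x (n+1) - x n‖^2 := ⟨_, rfl⟩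
  have hcy : 0 < (1 - κ) / β := div_pos (by linarith) hβ
  have hEnn : ∀ a b n, 0 ≤ E a b n := by intro a b n; rw [hE]; positivity
  have hDnn : ∀ n, 0 ≤ D n := by intro n; rw [hD]; positivity
  have hdec : ∀ (a : X) (b : Y),
      (∀ (x' : X) (w' : Y), f a + h a + g (K a) ≤ f x' + h x' + g w' + ⟪b, K x' - w'⟫_ℝ) →
      ∀ n, N ≤ n → E a b (n+1) + D n ≤ E a b n := by
    intro a b hab n hn
    have hyn : y (n+1) = y n + (β * τ (n+1)) • (K (x (n+1)) - w (n+1)) := by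
      simpa using hy (n+1) (by omega)
    have hst := aux_step K f g h Gh hgr ψ β κ μ' hψ1 hβ hμ'0 (by linarith) a b hab
      (x n) (x (n+1)) (x (n+2)) (z (n+1)) (z (n+2)) (z (n+3)) (w (n+1)) (y n) (y (n+1))
      (τ n) (τ (n+1)) (τ (n+1) / τ n) S (hτp n) (by have := (hτp n).ne'; field_simp)
      (div_pos (hτp _) (hτp _)) hS (by simpa using hz (n+2) (by omega))
      (by simpa using hz (n+3) (by omega))
      (by simpa using hx (n+1) (by omega) (x (n+2)))
      (by simpa using hx (n+2) (by omega) a)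
      (by rw [hyn]; simpa using hw (n+1) (by omega) (K a))
      hyn ?_ (hτG n)
    · have hm := (hN n hn).2
      have : (2 * μ - κ - 2 * μ') * ‖x (n+2) - x (n+1)‖^2 ≤
        (ψ * (τ (n+1) / τ n) + (S - ψ * (τ (n+1) / τ n)) * (ψ * (τ (n+1) / τ n)) / S - κ - 2 * μ')
          * ‖x (n+2) - x (n+1)‖^2 :=
        mul_le_mul_of_nonneg_right (by linarith) (by positivity)
      rw [hE, hD, hV]
      simp only
      linarith
    · have h1 := (hN n hn).1
      have h2 := hτK (n+1)
      have hp := hτp (n+2)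
      have hp1 := hτp (n+1)
      have h3 := mul_le_mul_of_nonneg_left h2 (div_pos hp1 hp).le
      have h4 := mul_le_mul_of_nonneg_right h1.le (norm_nonneg (x (n+2) - x (n+1)))
      have e1 : τ (n + 1) / τ (n + 2) * (τ (n + 1 + 1) * (√β * ‖K (x (n + 1 + 1) - x (n + 1))‖))
        = τ (n+1) * (√β * ‖K (x (n + 2) - x (n + 1))‖) := by
        field_simp
      have e2 : τ (n + 1) / τ (n + 2) * (μ * ‖x (n + 1 + 1) - x (n + 1)‖)
        = μ * τ (n+1) / τ (n+2) * ‖x (n + 2) - x (n + 1)‖ := by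
        ring
      rw [e1, e2] at h3
      exact h3.trans h4
  -- the given saddle point
  have hwb : K xb - wb = 0 := by
    have := (hsaddle xb wb (yb + (K xb - wb))).1
    rw [inner_add_left] at this
    have h2 : ⟪K xb - wb, K xb - wb⟫_ℝ ≤ 0 := by linarith
    rw [real_inner_self_eq_norm_sq] at h2
    have h3 : ‖K xb - wb‖ = 0 := by nlinarith [norm_nonneg (K xb - wb)]
    exact norm_eq_zero.1 h3
  have hwb' : wb = K xb := (sub_eq_zero.1 hwb).symm
  have hsad : ∀ (x' : X) (w' : Y),
      f xb + h xb + g (K xb) ≤ f x' + h x' + g w' + ⟪yb, K x' - w'⟫_ℝ := by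
    intro x' w'
    have := (hsaddle x' w' yb).2
    rw [hwb, hwb', inner_zero_right] at this
    linarith
  obtain ⟨hD0, l, hEl⟩ := aux_seq (E xb yb) D N (hEnn _ _) (fun n _ => hDnn n) (hdec xb yb hsad)
  have hdy : Tendsto (fun n => y (n+1) - y n) atTop (𝓝 0) := by
    refine aux_sq0 _ D _ hcy hD0 (Eventually.of_forall fun n => ?_)
    rw [hD]
    have : 0 ≤ (2 * μ - κ - 2 * μ') * ‖x (n+2) - x (n+1)‖^2 := by positivity
    have : 0 ≤ S * ‖V n‖^2 := by positivity
    simp only; linarith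
  have hdx : Tendsto (fun n => x (n+2) - x (n+1)) atTop (𝓝 0) := by
    refine aux_sq0 _ D _ hκ3 hD0 (Eventually.of_forall fun n => ?_)
    rw [hD]
    have : 0 ≤ (1 - κ) / β * ‖y (n+1) - y n‖^2 := by positivity
    have : 0 ≤ S * ‖V n‖^2 := by positivity
    simp only; linarith
  have hV0 : Tendsto V atTop (𝓝 0) := by
    refine aux_sq0 _ D _ hSp hD0 (Eventually.of_forall fun n => ?_)
    rw [hD]
    have : 0 ≤ (1 - κ) / β * ‖y (n+1) - y n‖^2 := by positivity
    have : 0 ≤ (2 * μ - κ - 2 * μ') * ‖x (n+2) - x (n+1)‖^2 := by positivity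
    simp only; linarith
  have hxz : Tendsto (fun n => x (n+1) - z (n+2)) atTop (𝓝 0) := by
    have h1 : Tendsto (fun n => (S - ψ * (τ (n+1) / τ n)) / S) atTop (𝓝 ((S - ψ * 1) / S)) :=
      (tendsto_const_nhds.sub (hδ.const_mul ψ)).div_const S
    have h2 := hV0.sub (h1.smul hdx)
    rw [smul_zero, sub_zero] at h2
    refine h2.congr fun n => ?_
    rw [hV]; simp
  have hdx' : Tendsto (fun n => x (n+1) - x n) atTop (𝓝 0) :=
    (tendsto_add_atTop_iff_nat (f := fun n => x (n+1) - x n) 1).1 hdx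
  have hKw : Tendsto (fun n => K (x (n+1)) - w (n+1)) atTop (𝓝 0) := by
    have h1 : Tendsto (fun n => (β * τ (n+1))⁻¹) atTop (𝓝 (β * T)⁻¹) :=
      (hτT1.const_mul β).inv₀ (by positivity)
    have h2 := h1.smul hdy
    rw [smul_zero] at h2
    refine h2.congr fun n => ?_
    have hyn : y (n+1) = y n + (β * τ (n+1)) • (K (x (n+1)) - w (n+1)) := by
      simpa using hy (n+1) (by omega)
    have hp := hτp (n+1)
    rw [hyn, add_sub_cancel_left, smul_smul, inv_mul_cancel₀ (by positivity), one_smul]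
  -- boundedness and cluster point
  obtain ⟨φ, xt, yt, hφ, hzt, hyt⟩ : ∃ (φ : ℕ → ℕ) (xt : X) (yt : Y), Tendsto φ atTop atTop ∧
      Tendsto (fun n => z (φ n + 2)) atTop (𝓝 xt) ∧ Tendsto (fun n => y (φ n)) atTop (𝓝 yt) := by
    obtain ⟨C, hC⟩ := hEl.bddAbove_range
    have hC' : ∀ n, E xb yb n ≤ C := fun n => hC ⟨n, rfl⟩
    have hb1 : ∀ n, ‖z (n+2) - xb‖ ≤ √(C / (ψ / (ψ - 1))) := fun n => by
      refine Real.le_sqrt_of_sq_le ?_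
      rw [le_div_iff₀ (by positivity)]
      have h1 := hC' n
      rw [hE] at h1
      have : 0 ≤ 1 / β * ‖y n - yb‖^2 := by positivity
      have : 0 ≤ μ' * ‖x (n+1) - x n‖^2 := by positivity
      simp only at h1
      linarith
    have hb2 : ∀ n, ‖y n - yb‖ ≤ √(C / (1 / β)) := fun n => by
      refine Real.le_sqrt_of_sq_le ?_
      rw [le_div_iff₀ (by positivity)]
      have h1 := hC' n
      rw [hE] at h1
      have : 0 ≤ ψ / (ψ - 1) * ‖z (n+2) - xb‖^2 := by positivity
      have : 0 ≤ μ' * ‖x (n+1) - x n‖^2 := by positivity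
      simp only at h1
      linarith
    obtain ⟨p, -, φ, hφ, hp⟩ := tendsto_subseq_of_bounded
      (x := fun n => (z (n+2), y n))
      (Bornology.IsBounded.prod (Metric.isBounded_closedBall (x := xb) (r := √(C / (ψ / (ψ - 1)))))
        (Metric.isBounded_closedBall (x := yb) (r := √(C / (1 / β)))))
      (fun n => ⟨by simpa [dist_eq_norm] using hb1 n, by simpa [dist_eq_norm] using hb2 n⟩)
    refine ⟨φ, p.1, p.2, hφ.tendsto_atTop, ?_, ?_⟩
    · exact (continuous_fst.tendsto p).comp hp
    · exact (continuous_snd.tendsto p).comp hp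
  have hx1 : Tendsto (fun n => x (φ n + 1)) atTop (𝓝 xt) := by
    have := (hxz.comp hφ).add hzt
    simpa [Function.comp_def] using this
  have hx2 : Tendsto (fun n => x (φ n + 2)) atTop (𝓝 xt) := by
    have := (hdx.comp hφ).add hx1
    simpa [Function.comp_def] using this
  have hy1 : Tendsto (fun n => y (φ n + 1)) atTop (𝓝 yt) := by
    have := (hdy.comp hφ).add hyt
    simpa [Function.comp_def] using this
  have hw1 : Tendsto (fun n => w (φ n + 1)) atTop (𝓝 (K xt)) := by
    have := ((K.continuous.tendsto xt).comp hx1).sub (hKw.comp hφ)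
    simpa [Function.comp_def] using this
  have hτφ := hτT1.comp hφ
  have hfl : ∀ u, f xt - f u ≤ ⟪yt, K u - K xt⟫_ℝ + ⟪Gh xt, u - xt⟫_ℝ := by
    intro u
    have hl := hτφ.mul (((hfc.tendsto xt).comp hx2).sub (tendsto_const_nhds (x := f u)))
    have hr := (((hx2.sub hzt).add (hτφ.smul
      (((ContinuousLinearMap.adjoint K).continuous.tendsto yt).comp hy1))).add
      (hτφ.smul ((hGc.tendsto xt).comp hx1))).inner (𝕜 := ℝ)
      ((tendsto_const_nhds (x := u)).sub hx2)
    have := le_of_tendsto_of_tendsto' hl hr fun n => by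
      simpa using hx (φ n + 2) (by omega) u
    rw [sub_self, zero_add, ← smul_add, real_inner_smul_left, inner_add_left,
      ContinuousLinearMap.adjoint_inner_left, map_sub] at this
    exact le_of_mul_le_mul_left this hT
  have hgl : ∀ v, g (K xt) - g v ≤ ⟪yt, K xt - v⟫_ℝ := by
    intro v
    have hl := ((hgc.tendsto (K xt)).comp hw1).sub (tendsto_const_nhds (x := g v))
    have hr := hy1.inner (𝕜 := ℝ) (hw1.sub (tendsto_const_nhds (x := v)))
    refine le_of_tendsto_of_tendsto' hl hr fun n => ?_
    have hyn : y (φ n+1) = y (φ n) + (β * τ (φ n+1)) • (K (x (φ n+1)) - w (φ n+1)) := by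
      simpa using hy (φ n+1) (by omega)
    rw [hyn]
    simpa using hw (φ n + 1) (by omega) v
  have hsadt : ∀ (x' : X) (w' : Y),
      f xt + h xt + g (K xt) ≤ f x' + h x' + g w' + ⟪yt, K x' - w'⟫_ℝ := by
    intro x' w'
    have h1 := hfl x'
    have h2 := hgl w'
    have h3 := hgr xt x'
    rw [inner_sub_right] at h1 h2 ⊢
    linarith
  -- full convergence
  obtain ⟨-, l', hEl'⟩ := aux_seq (E xt yt) D N (hEnn _ _) (fun n _ => hDnn n) (hdec xt yt hsadt)
  have hE0 : Tendsto (E xt yt) atTop (𝓝 0) := by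
    have h1 : Tendsto (fun n => E xt yt (φ n)) atTop (𝓝 0) := by
      have a := ((hzt.sub (tendsto_const_nhds (x := xt))).norm.pow 2).const_mul (ψ / (ψ - 1))
      have b := ((hyt.sub (tendsto_const_nhds (x := yt))).norm.pow 2).const_mul (1 / β)
      have c := ((hdx'.comp hφ).norm.pow 2).const_mul μ'
      have d := (a.add b).add c
      rw [hE]
      simpa using d
    have := tendsto_nhds_unique h1 (hEl'.comp hφ)
    rwa [← this] at hEl'
  have hzf : Tendsto (fun n => z (n+2) - xt) atTop (𝓝 0) := by
    refine aux_sq0 _ _ (ψ / (ψ - 1)) (by positivity) hE0 (Eventually.of_forall fun n => ?_)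
    rw [hE]
    have : 0 ≤ 1 / β * ‖y n - yt‖^2 := by positivity
    have : 0 ≤ μ' * ‖x (n+1) - x n‖^2 := by positivity
    simp only; linarith
  have hyf : Tendsto (fun n => y n - yt) atTop (𝓝 0) := by
    refine aux_sq0 _ _ (1 / β) (by positivity) hE0 (Eventually.of_forall fun n => ?_)
    rw [hE]
    have : 0 ≤ ψ / (ψ - 1) * ‖z (n+2) - xt‖^2 := by positivity
    have : 0 ≤ μ' * ‖x (n+1) - x n‖^2 := by positivity
    simp only; linarith
  have hxf : Tendsto x atTop (𝓝 xt) := by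
    rw [← tendsto_add_atTop_iff_nat 1]
    have := (hxz.add hzf).add (tendsto_const_nhds (x := xt))
    simpa using this
  have hyf' : Tendsto y atTop (𝓝 yt) := by
    have := hyf.add (tendsto_const_nhds (x := yt))
    simpa using this
  refine ⟨xt, yt, hxf.prodMk_nhds hyf', fun y' => by simp, fun x' w' => ?_⟩
  rw [sub_self, inner_zero_right, add_zero]
  exact hsadt x' w'
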